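/- For all real numbers u, r, p, w_r with r ≥ 0 and x = u + r + p, the quadratic objective is an upper bound on the piecewise-affine objective: J^QP = t̃(x)·u + w_r·r + t0·r·(a·ε1(x) + b·ε2(x)), and consequently J^QP ≥ t̃(x)·u + w_r·r. -/

import Mathlib

/-- Second slack variable: excess flow over the second threshold. -/
noncomputable def eps2 (xth2 x : ℝ) : ℝ := max 0 (x - xth2)

/-- First slack variable: excess flow over the first threshold, capped. -/
noncomputable def eps1 (xth1 xth2 x : ℝ) : ℝ := max 0 (x - xth1 - eps2 xth2 x)

/-- Piecewise-affine travel time function. -/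
noncomputable def ttilde (t0 a b xth1 xth2 x : ℝ) : ℝ :=
  if x < xth1 then t0
  else if x < xth2 then t0 * (1 + a * (x - xth1))
  else t0 * (1 + a * (xth2 - xth1) + b * (x - xth2))

/-- Per-edge quadratic-program objective. -/
noncomputable def JQP (t0 a b xth1 xth2 u r p wr : ℝ) : ℝ :=
  t0 * u
    + a * t0 * eps1 xth1 xth2 (u + r + p) * (eps1 xth1 xth2 (u + r + p) + xth1 - p)
    + b * t0 * eps2 xth2 (u + r + p) * (eps2 xth2 (u + r + p) + xth2 - p)
    + a * t0 * (xth2 - xth1) * eps2 xth2 (u + r + p)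
    + wr * r

/-- the quadratic objective equals the piecewise-affine objective
plus the nonnegative term `t0·r·(a·ε1 x + b·ε2 x)`, hence upper-bounds it. -/
theorem JQP_upper_bound (t0 a b xth1 xth2 : ℝ)
    (ht0 : 0 < t0) (ha : 0 ≤ a) (hb : 0 ≤ b)
    (hth1 : 0 ≤ xth1) (hth : xth1 ≤ xth2) :
    ∀ u r p wr x : ℝ, 0 ≤ r → x = u + r + p →
      JQP t0 a b xth1 xth2 u r p wr
          = ttilde t0 a b xth1 xth2 x * u + wr * r
            + t0 * r * (a * eps1 xth1 xth2 x + b * eps2 xth2 x) ∧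
      JQP t0 a b xth1 xth2 u r p wr ≥ ttilde t0 a b xth1 xth2 x * u + wr * r := by
  intro u r p wr x hr hx
  have decomposition : JQP t0 a b xth1 xth2 u r p wr
      = ttilde t0 a b xth1 xth2 x * u + wr * r
        + t0 * r * (a * eps1 xth1 xth2 x + b * eps2 xth2 x) := by
    have hp : p = x - u - r := by linarith
    unfold JQP
    rw [← hx]
    rcases lt_or_ge x xth2 with h2 | h2
    · have e2 : eps2 xth2 x = 0 := max_eq_left (by linarith)
      rcases lt_or_ge x xth1 with h1 | h1
      · have e1 : eps1 xth1 xth2 x = 0 := max_eq_left (by linarith)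
        rw [e1, e2, ttilde, if_pos h1]
        ring
      · have e1 : eps1 xth1 xth2 x = x - xth1 := by
          rw [eps1, e2, sub_zero, max_eq_right (by linarith)]
        rw [e1, e2, ttilde, if_neg h1.not_gt, if_pos h2, hp]
        ring
    · have e2 : eps2 xth2 x = x - xth2 := max_eq_right (by linarith)
      have e1 : eps1 xth1 xth2 x = xth2 - xth1 := by
        rw [eps1, e2, max_eq_right (by linarith)]
        ring
      rw [e1, e2, ttilde, if_neg (hth.trans h2).not_gt, if_neg h2.not_gt, hp]
      ring
  refine ⟨decomposition, ?_⟩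
  have h1 : 0 ≤ eps1 xth1 xth2 x := le_max_left _ _
  have h2 : 0 ≤ eps2 xth2 x := le_max_left _ _
  have gap : 0 ≤ t0 * r * (a * eps1 xth1 xth2 x + b * eps2 xth2 x) := by positivity
  linarith
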